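/- Let k be an algebraically closed field of characteristic p, and let S be a complete noetherian local k-algebra with residue field k. Let (x_1, …, x_d) be a system of parameters of S, and let D be an S-algebra equipped with a compatible system of p-th power roots (π_e)_{e ≥ 0} of an element π = π_0 ∈ D, π ≠ 0, such that D is π^{1/p^∞}-almost Cohen-Macaulay with respect to (x_1, …, x_d). Then there exist an S-algebra C and an S-algebra homomorphism D → C such that C is a domain, C is a perfect ring (the Frobenius endomorphism x ↦ x^p of C is bijective), and C is a (big) Cohen-Macaulay S-algebra (Cohen-Macaulay with respect to every system of parameters of S). -/

import Mathlib

/-- A finite sequence `y` of elements of a commutative ring `B` is a regular sequence on `B`: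
for each `i`, multiplication by `y i` is injective on `B/(y_1,…,y_{i-1})B`,
and `B ≠ (y_1,…,y_m)B`. -/
def IsRegSeq {B : Type*} [CommRing B] {m : ℕ} (y : Fin m → B) : Prop :=
  (∀ i : Fin m, ∀ b : B,
      y i * b ∈ Ideal.span (y '' {j : Fin m | j < i}) →
        b ∈ Ideal.span (y '' {j : Fin m | j < i})) ∧
  Ideal.span (Set.range y) ≠ ⊤

/-- A `B`-algebra (given by a ring hom `φ : R →+* B`) is Cohen-Macaulay with respect to a
sequence `x` of elements of `R` if `x` becomes a regular sequence in `B`. -/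
def IsCMwrt {R B : Type*} [CommRing R] [CommRing B] (φ : R →+* B)
    {d : ℕ} (x : Fin d → R) : Prop :=
  IsRegSeq fun i => φ (x i)

/-- `x` is a system of parameters of the noetherian local ring `R`: `d` is the Krull dimension,
all `x i` lie in the maximal ideal, and they generate an ideal whose radical is the maximal
ideal. -/
def IsSOP (R : Type*) [CommRing R] [IsLocalRing R] {d : ℕ} (x : Fin d → R) : Prop :=
  (d : WithBot ℕ∞) = ringKrullDim R ∧
  (∀ i, x i ∈ IsLocalRing.maximalIdeal R) ∧
  (Ideal.span (Set.range x)).radical = IsLocalRing.maximalIdeal R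

/-- `B` (via the structure map `φ`) is a big Cohen-Macaulay `R`-algebra: it is Cohen-Macaulay
with respect to every system of parameters of `R`. -/
def IsBigCM {R B : Type*} [CommRing R] [IsLocalRing R] [CommRing B] (φ : R →+* B) : Prop :=
  ∀ (d : ℕ) (x : Fin d → R), IsSOP R x → IsCMwrt φ x

/-- `A` (as an `R`-algebra) is an absolute integral closure of the domain `R`:
it is a domain containing `R`, integral over `R`, and absolutely integrally closed
(every monic polynomial of positive degree has a root); equivalently, it is the
integral closure of `R` in an algebraic closure of its fraction field. -/
structure IsAbsIntClosure (R A : Type*) [CommRing R] [CommRing A] [Algebra R A] : Prop where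
  isDomain : IsDomain A
  injective : Function.Injective (algebraMap R A)
  isIntegral : Algebra.IsIntegral R A
  monic_root : ∀ P : Polynomial A, P.Monic → 0 < P.degree → ∃ a : A, P.IsRoot a

/-- `B` is `π^{1/p^∞}`-almost Cohen-Macaulay with respect to `x`, where `π : ℕ → B` is a
compatible system of `p`-th power roots. -/
def IsAlmostCMwrt {R B : Type*} [CommRing R] [CommRing B] (φ : R →+* B)
    (π : ℕ → B) {d : ℕ} (x : Fin d → R) : Prop :=
  (∀ i : Fin d, ∀ b : B,
      φ (x i) * b ∈ Ideal.span ((fun j => φ (x j)) '' {j : Fin d | j < i}) →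
        ∀ e : ℕ, π e * b ∈ Ideal.span ((fun j => φ (x j)) '' {j : Fin d | j < i})) ∧
  ¬ Ideal.span (Set.range π) ≤ Ideal.span (Set.range fun j => φ (x j))


section WeaklyRegularLists

variable {B : Type*} [CommRing B]

/-- The list `L` is weakly regular on `B / J`, phrased with ideals of `B` only. -/
def WeaklyRegularMod : Ideal B → List B → Prop
  | _, [] => True
  | J, a :: L => (∀ u, a * u ∈ J → u ∈ J) ∧ WeaklyRegularMod (J ⊔ Ideal.span {a}) L

theorem mem_sup_span_singleton_iff {J : Ideal B} {a u : B} :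
    u ∈ J ⊔ Ideal.span {a} ↔ ∃ w, u - a * w ∈ J := by
  constructor
  · intro h
    obtain ⟨j, hj, c, hc, rfl⟩ := Submodule.mem_sup.1 h
    obtain ⟨w, rfl⟩ := Ideal.mem_span_singleton'.1 hc
    exact ⟨w, by convert hj using 1; ring⟩
  · rintro ⟨w, hw⟩
    rw [show u = (u - a * w) + w * a by ring]
    exact Submodule.add_mem_sup hw (Ideal.mem_span_singleton'.2 ⟨w, rfl⟩)

theorem cancel_mod_swap {J : Ideal B} {a l : B} (ha : ∀ u, a * u ∈ J → u ∈ J)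
    (hl : ∀ u, l * u ∈ J ⊔ Ideal.span {a} → u ∈ J ⊔ Ideal.span {a}) (u : B)
    (hu : a * u ∈ J ⊔ Ideal.span {l}) : u ∈ J ⊔ Ideal.span {l} := by
  obtain ⟨v, hv⟩ := mem_sup_span_singleton_iff.1 hu
  obtain ⟨w, hw⟩ := mem_sup_span_singleton_iff.1
    (hl v (mem_sup_span_singleton_iff.2 ⟨u, by
      rw [← neg_sub]; exact J.neg_mem hv⟩))
  refine mem_sup_span_singleton_iff.2 ⟨w, ha _ ?_⟩
  rw [show a * (u - l * w) = (a * u - l * v) + l * (v - a * w) by ring]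
  exact J.add_mem hv (J.mul_mem_left _ hw)

/-- If `a` followed by `L` is weakly regular modulo `J`, then `a` is regular modulo `J + (L)`. -/
theorem WeaklyRegularMod.cancel_mod_ofList {L : List B} {J : Ideal B} {a : B}
    (h : WeaklyRegularMod J (a :: L)) (u : B) (hu : a * u ∈ J ⊔ Ideal.ofList L) :
    u ∈ J ⊔ Ideal.ofList L := by
  induction L generalizing J with
  | nil => simpa using h.1 u (by simpa using hu)
  | cons l L ih =>
    rw [Ideal.ofList_cons, ← sup_assoc] at hu ⊢
    refine ih ⟨cancel_mod_swap h.1 h.2.1, ?_⟩ hu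
    rw [sup_right_comm]
    exact h.2.2

theorem weaklyRegularMod_append {J : Ideal B} {L L' : List B} :
    WeaklyRegularMod J (L ++ L') ↔
      WeaklyRegularMod J L ∧ WeaklyRegularMod (J ⊔ Ideal.ofList L) L' := by
  induction L generalizing J with
  | nil => simp [WeaklyRegularMod]
  | cons a L ih => simp [WeaklyRegularMod, ih, Ideal.ofList_cons, sup_assoc, and_assoc]

theorem cancel_pow_mod {J : Ideal B} {a l : B} (ha : ∀ u, a * u ∈ J → u ∈ J)
    (hl : ∀ u, l * u ∈ J ⊔ Ideal.span {a} → u ∈ J ⊔ Ideal.span {a}) (n : ℕ) (u : B)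
    (hu : l * u ∈ J ⊔ Ideal.span {a ^ n}) : u ∈ J ⊔ Ideal.span {a ^ n} := by
  induction n generalizing u with
  | zero => simp
  | succ n ih =>
    obtain ⟨w, hw⟩ := mem_sup_span_singleton_iff.1 hu
    obtain ⟨v, hv⟩ := mem_sup_span_singleton_iff.1
      (hl u (mem_sup_span_singleton_iff.2 ⟨a ^ n * w, by convert hw using 1; ring⟩))
    have key : l * v ∈ J ⊔ Ideal.span {a ^ n} := by
      refine mem_sup_span_singleton_iff.2 ⟨w, ha _ ?_⟩
      rw [show a * (l * v - a ^ n * w) = (l * u - a ^ (n + 1) * w) - l * (u - a * v) by ring]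
      exact J.sub_mem hw (J.mul_mem_left _ hv)
    obtain ⟨t, ht⟩ := mem_sup_span_singleton_iff.1 (ih v key)
    refine mem_sup_span_singleton_iff.2 ⟨t, ?_⟩
    rw [show u - a ^ (n + 1) * t = (u - a * v) + a * (v - a ^ n * t) by ring]
    exact J.add_mem hv (J.mul_mem_left _ ht)

theorem WeaklyRegularMod.sup_pow {L : List B} {J : Ideal B} {a : B}
    (h : WeaklyRegularMod J (a :: L)) (n : ℕ) :
    WeaklyRegularMod (J ⊔ Ideal.span {a ^ n}) L := by
  induction L generalizing J with
  | nil => trivial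
  | cons l L ih =>
    refine ⟨cancel_pow_mod h.1 h.2.1 n, ?_⟩
    rw [sup_right_comm]
    refine ih ⟨cancel_mod_swap h.1 h.2.1, ?_⟩
    rw [sup_right_comm]
    exact h.2.2

theorem cancel_of_cancel_pow {J : Ideal B} {a : B} (n : ℕ) (ha : ∀ u, a * u ∈ J → u ∈ J) (u : B)
    (hu : a ^ n * u ∈ J) : u ∈ J := by
  induction n with
  | zero => simpa using hu
  | succ n ih => exact ih (ha _ (by convert hu using 1; ring))

theorem WeaklyRegularMod.map_pow {L : List B} {J : Ideal B} (h : WeaklyRegularMod J L) (n : ℕ) :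
    WeaklyRegularMod J (L.map (· ^ n)) := by
  induction L generalizing J with
  | nil => trivial
  | cons a L ih => exact ⟨cancel_of_cancel_pow n h.1, ih (h.sup_pow n)⟩

/-- In a ring where finitely generated ideals are closed for the topologies defined by the
elements of `T`, weak regularity of lists of elements of `T` is invariant under permutation. -/
theorem WeaklyRegularMod.perm {T : Set B}
    (hT : ∀ J : Ideal B, J.FG → ∀ a ∈ T, ∀ u, (∀ n, u ∈ J ⊔ Ideal.span {a ^ n}) → u ∈ J)
    {L L' : List B} (hp : L.Perm L') {J : Ideal B} (hJ : J.FG) (hL : ∀ a ∈ L, a ∈ T)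
    (h : WeaklyRegularMod J L) : WeaklyRegularMod J L' := by
  induction hp generalizing J with
  | nil => trivial
  | cons a _ ih =>
    exact ⟨h.1, ih (Submodule.FG.sup hJ (Submodule.fg_span_singleton a))
      (fun b hb => hL b (List.mem_cons_of_mem _ hb)) h.2⟩
  | swap a b L =>
    have hb := h.1
    have ha := h.2.1
    refine ⟨fun u hu => hT J hJ b (hL b (by simp)) u fun n => ?_, cancel_mod_swap hb ha, ?_⟩
    · induction n with
      | zero => simp
      | succ n ih =>
        obtain ⟨w, hw⟩ := mem_sup_span_singleton_iff.1 ih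
        have haw : a * w ∈ J := by
          refine cancel_of_cancel_pow n hb _ ?_
          rw [show b ^ n * (a * w) = a * u - a * (u - b ^ n * w) by ring]
          exact J.sub_mem hu (J.mul_mem_left _ hw)
        obtain ⟨t, ht⟩ := mem_sup_span_singleton_iff.1
          (ha w (Ideal.mem_sup_left haw))
        refine mem_sup_span_singleton_iff.2 ⟨t, ?_⟩
        rw [show u - b ^ (n + 1) * t = (u - b ^ n * w) + b ^ n * (w - b * t) by ring]
        exact J.add_mem hw (J.mul_mem_left _ ht)
    · rw [sup_right_comm]
      exact h.2.2
  | trans hp₁ _ ih₁ ih₂ =>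
    exact ih₂ hJ (fun b hb => hL b (hp₁.mem_iff.2 hb)) (ih₁ hJ hL h)

theorem image_setOf_lt_succ {m : ℕ} (y : Fin (m + 1) → B) (i : Fin m) :
    Ideal.span (y '' {j | j < i.succ}) =
      Ideal.span {y 0} ⊔ Ideal.span ((fun j => y j.succ) '' {j | j < i}) := by
  rw [← Ideal.span_union]
  congr 1
  ext b
  simp only [Set.mem_image, Set.mem_ofPred_eq, Set.singleton_union, Set.mem_insert_iff]
  constructor
  · rintro ⟨j, hj, rfl⟩
    induction j using Fin.cases with
    | zero => exact Or.inl rfl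
    | succ j => exact Or.inr ⟨j, by simpa using hj, rfl⟩
  · rintro (rfl | ⟨j, hj, rfl⟩)
    · exact ⟨0, Fin.succ_pos i, rfl⟩
    · exact ⟨j.succ, by simpa using hj, rfl⟩

theorem weaklyRegularMod_ofFn {m : ℕ} (y : Fin m → B) (J : Ideal B) :
    WeaklyRegularMod J (List.ofFn y) ↔
      ∀ i u, y i * u ∈ J ⊔ Ideal.span (y '' {j | j < i}) →
        u ∈ J ⊔ Ideal.span (y '' {j | j < i}) := by
  induction m generalizing J with
  | zero => simp [WeaklyRegularMod]
  | succ m ih =>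
    rw [List.ofFn_succ, WeaklyRegularMod, ih, Fin.forall_fin_succ]
    simp [image_setOf_lt_succ, sup_assoc]

theorem ofList_ofFn {m : ℕ} (y : Fin m → B) :
    Ideal.ofList (List.ofFn y) = Ideal.span (Set.range y) := by
  rw [Ideal.ofList]
  congr 1
  ext b
  simp [List.mem_ofFn]

theorem isRegSeq_iff {m : ℕ} (y : Fin m → B) :
    IsRegSeq y ↔ WeaklyRegularMod ⊥ (List.ofFn y) ∧ Ideal.span (Set.range y) ≠ ⊤ := by
  simp [IsRegSeq, weaklyRegularMod_ofFn]

end WeaklyRegularLists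

section Exchange

theorem ncard_setOf_mem_le {α : Type*} (L : List α) : {s | s ∈ L}.ncard ≤ L.length := by
  classical
  rw [← List.coe_toFinset, Set.ncard_coe_finset]
  exact L.toFinset_card_le

variable {S : Type*} [CommRing S] [IsLocalRing S]

open IsLocalRing

theorem WeaklyRegularMod.replace_last {B : Type*} [CommRing B] (φ : S →+* B) {L : List S} {a z : S}
    (hz : (Ideal.ofList L ⊔ Ideal.span {z}).radical = maximalIdeal S) (ha : a ∈ maximalIdeal S)
    (h : WeaklyRegularMod ⊥ ((L ++ [a]).map φ)) : WeaklyRegularMod ⊥ ((L ++ [z]).map φ) := by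
  rw [List.map_append, weaklyRegularMod_append, bot_sup_eq] at h ⊢
  refine ⟨h.1, fun u hu => ?_, trivial⟩
  obtain ⟨n, hn⟩ := hz.ge ha
  obtain ⟨w, hw⟩ := mem_sup_span_singleton_iff.1 hn
  refine cancel_of_cancel_pow n h.2.1 _ ?_
  have := Ideal.mem_map_of_mem φ hw
  rw [Ideal.map_ofList] at this
  rw [← _root_.map_pow, show φ (a ^ n) * u = φ (a ^ n - z * w) * u + φ w * (φ z * u) by
    rw [map_sub, map_mul]; ring]
  exact Ideal.add_mem _ (Ideal.mul_mem_right _ _ this) (Ideal.mul_mem_left _ _ hu)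

variable [IsNoetherianRing S]

theorem radical_sup_span_singleton_eq_maximalIdeal {K : Ideal S} {a z : S}
    (ha : (K ⊔ Ideal.span {a}).radical = maximalIdeal S) (hz : z ∈ maximalIdeal S)
    (hzK : ∀ Q ∈ K.minimalPrimes, z ∉ Q) :
    (K ⊔ Ideal.span {z}).radical = maximalIdeal S := by
  have hK : K ≤ maximalIdeal S := le_sup_left.trans (Ideal.le_radical.trans ha.le)
  have haM : a ∈ maximalIdeal S := ha.le (Ideal.le_radical
    (Ideal.mem_sup_right (Ideal.mem_span_singleton_self a)))
  refine le_antisymm ?_ ?_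
  · rw [(maximalIdeal.isMaximal S).isPrime.radical_le_iff]
    exact sup_le hK ((Ideal.span_singleton_le_iff_mem _).2 hz)
  rw [Ideal.radical_eq_sInf]
  refine le_sInf fun P ⟨hKP, hP⟩ => ?_
  obtain ⟨Q, hQ, hQP⟩ := Ideal.exists_minimalPrimes_le (le_sup_left.trans hKP)
  have hQp : Q.IsPrime := hQ.1.1
  have hlt : Q < P := lt_of_le_of_ne hQP fun h => hzK Q hQ
    (h ▸ hKP (Ideal.mem_sup_right (Ideal.mem_span_singleton_self z)))
  have hPM : P ≤ maximalIdeal S := le_maximalIdeal hP.ne_top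
  by_contra hcon
  have hlt' : P < maximalIdeal S := lt_of_le_not_ge hPM hcon
  have hmin : maximalIdeal S ∈ (Q ⊔ Ideal.span {a}).minimalPrimes := by
    refine ⟨⟨(maximalIdeal.isMaximal S).isPrime, sup_le (hQP.trans hPM)
      ((Ideal.span_singleton_le_iff_mem _).2 haM)⟩, fun R ⟨hR, hQR⟩ _ => ?_⟩
    rw [← ha, hR.radical_le_iff]
    exact (sup_le_sup_right hQ.1.2 _).trans hQR
  have hle := Ideal.map_height_le_one_of_mem_minimalPrimes hmin
  have hker : RingHom.ker (Ideal.Quotient.mk Q) ≤ P := Q.mk_ker.trans_le hQP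
  have hker' : RingHom.ker (Ideal.Quotient.mk Q) ≤ maximalIdeal S := hker.trans hPM
  have hsurj : Function.Surjective (Ideal.Quotient.mk Q) := Ideal.Quotient.mk_surjective
  have hP' := Ideal.map_isPrime_of_surjective hsurj hker
  have hM' := Ideal.map_isPrime_of_surjective hsurj hker'
  have hmem : ∀ {I : Ideal S}, Q ≤ I → ∀ s, Ideal.Quotient.mk Q s ∈ I.map (Ideal.Quotient.mk Q) →
      s ∈ I := by
    intro I hI s hs
    rwa [← Ideal.mem_comap, Ideal.comap_map_of_surjective' _ hsurj, Ideal.mk_ker,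
      sup_eq_left.2 hI] at hs
  have h1 : (⊥ : Ideal (S ⧸ Q)) < P.map (Ideal.Quotient.mk Q) := by
    rw [bot_lt_iff_ne_bot]
    intro h
    refine hlt.not_ge fun s hs => ?_
    have := Ideal.mem_map_of_mem (Ideal.Quotient.mk Q) hs
    rw [h, Ideal.mem_bot] at this
    exact Ideal.Quotient.eq_zero_iff_mem.1 this
  have h2 : P.map (Ideal.Quotient.mk Q) < (maximalIdeal S).map (Ideal.Quotient.mk Q) := by
    refine lt_of_le_not_ge (Ideal.map_mono hPM) fun h => hcon fun s hs => ?_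
    exact hmem hQP s (h (Ideal.mem_map_of_mem _ hs))
  have e1 := Ideal.height_add_one_le_of_lt_of_isPrime h1
  have e2 := Ideal.height_add_one_le_of_lt_of_isPrime h2
  rw [Ideal.height_bot, zero_add] at e1
  have : (1 + 1 : ℕ∞) ≤ 1 := (add_le_add_left e1 1).trans (e2.trans hle)
  exact absurd this (by decide)

theorem exists_common_parameter {L₁ L₂ : List S} {a₁ a₂ : S}
    (h₁ : (Ideal.ofList L₁ ⊔ Ideal.span {a₁}).radical = maximalIdeal S)
    (h₂ : (Ideal.ofList L₂ ⊔ Ideal.span {a₂}).radical = maximalIdeal S)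
    (hL₁ : (L₁.length : WithBot ℕ∞) < ringKrullDim S)
    (hL₂ : (L₂.length : WithBot ℕ∞) < ringKrullDim S) :
    ∃ z ∈ maximalIdeal S, (Ideal.ofList L₁ ⊔ Ideal.span {z}).radical = maximalIdeal S ∧
      (Ideal.ofList L₂ ⊔ Ideal.span {z}).radical = maximalIdeal S := by
  have key : ∀ {L : List S}, (L.length : WithBot ℕ∞) < ringKrullDim S →
      ∀ Q ∈ (Ideal.ofList L).minimalPrimes, ¬ maximalIdeal S ≤ Q := by
    intro L hL Q hQ hle
    obtain rfl : Q = maximalIdeal S := ((maximalIdeal.isMaximal S).eq_of_le hQ.1.1.ne_top hle).symm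
    have := Ideal.height_le_card_of_mem_minimalPrimes_span (List.finite_toSet L) hQ
    rw [← maximalIdeal_height_eq_ringKrullDim] at hL
    have h2 := this.trans (Nat.cast_le.2 (ncard_setOf_mem_le L))
    exact hL.not_ge (by exact_mod_cast h2)
  have hfin := (Ideal.finite_minimalPrimes_of_isNoetherianRing S (Ideal.ofList L₁)).union
    (Ideal.finite_minimalPrimes_of_isNoetherianRing S (Ideal.ofList L₂))
  have hnot : ¬ ((maximalIdeal S : Set S) ⊆ ⋃ Q ∈ (Ideal.ofList L₁).minimalPrimes ∪
      (Ideal.ofList L₂).minimalPrimes, (id Q : Ideal S)) := by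
    rw [Ideal.subset_union_prime_finite hfin ⊥ ⊥]
    · rintro ⟨Q, hQ | hQ, hle⟩
      exacts [key hL₁ Q hQ hle, key hL₂ Q hQ hle]
    · rintro Q (hQ | hQ) _ _ <;> exact hQ.1.1
  obtain ⟨z, hz, hzn⟩ := Set.not_subset.1 hnot
  simp only [Set.mem_iUnion, not_exists] at hzn
  exact ⟨z, hz, radical_sup_span_singleton_eq_maximalIdeal h₁ hz fun Q hQ => hzn Q (Or.inl hQ),
    radical_sup_span_singleton_eq_maximalIdeal h₂ hz fun Q hQ => hzn Q (Or.inr hQ)⟩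

variable {B : Type*} [CommRing B] (φ : S →+* B)

theorem WeaklyRegularMod.exchange
    (hcl : ∀ J : Ideal B, J.FG → ∀ a ∈ maximalIdeal S, ∀ u,
      (∀ n, u ∈ J ⊔ Ideal.span {φ a ^ n}) → u ∈ J)
    (n : ℕ) {Z X Y : List S} (hX : X.length = n) (hY : Y.length = n)
    (hZ : ((Z.length + n : ℕ) : WithBot ℕ∞) = ringKrullDim S)
    (hZm : ∀ s ∈ Z, s ∈ maximalIdeal S)
    (hXm : (Ideal.ofList (Z ++ X)).radical = maximalIdeal S)
    (hYm : (Ideal.ofList (Z ++ Y)).radical = maximalIdeal S)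
    (h : WeaklyRegularMod ⊥ ((Z ++ X).map φ)) : WeaklyRegularMod ⊥ ((Z ++ Y).map φ) := by
  induction n generalizing Z X Y with
  | zero =>
    rw [List.length_eq_zero_iff] at hX hY
    rwa [hY, ← hX]
  | succ n ih =>
    have hmem : ∀ {L : List S}, (Ideal.ofList L).radical = maximalIdeal S →
        ∀ s ∈ L, s ∈ maximalIdeal S := fun hL s hs =>
      hL.le (Ideal.le_radical (Ideal.subset_span hs))
    obtain ⟨X, a, rfl⟩ := List.eq_nil_or_concat X |>.resolve_left (by rintro rfl; simp at hX)
    obtain ⟨Y, b, rfl⟩ := List.eq_nil_or_concat Y |>.resolve_left (by rintro rfl; simp at hY)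
    simp only [List.concat_eq_append, List.length_append, List.length_singleton,
      Nat.add_right_cancel_iff, ← List.append_assoc] at *
    have hlt : ∀ {L : List S}, L.length = n →
        (((Z ++ L).length : ℕ) : WithBot ℕ∞) < ringKrullDim S := by
      intro L hL
      rw [← hZ, List.length_append, hL]
      exact_mod_cast Nat.lt_succ_self _
    have haM := hmem hXm a (by simp)
    have hbM := hmem hYm b (by simp)
    have hXm' := hXm
    have hYm' := hYm
    rw [Ideal.ofList_append, Ideal.ofList_singleton] at hXm' hYm'
    obtain ⟨z, hz, hz₁, hz₂⟩ := exists_common_parameter hXm' hYm' (hlt hX) (hlt hY)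
    have hperm : ∀ L : List S, (Z ++ L ++ [z]).Perm (Z ++ [z] ++ L) := fun L => by
      simp only [List.append_assoc]
      exact List.perm_append_comm.append_left Z
    have hrad : ∀ {L : List S}, (Ideal.ofList (Z ++ L) ⊔ Ideal.span {z}).radical = maximalIdeal S →
        (Ideal.ofList (Z ++ [z] ++ L)).radical = maximalIdeal S := by
      intro L hL
      rw [← hL]
      simp only [Ideal.ofList_append, Ideal.ofList_singleton]
      rw [sup_right_comm]
    have hT : ∀ J : Ideal B, J.FG → ∀ a ∈ φ '' maximalIdeal S, ∀ u,
        (∀ n, u ∈ J ⊔ Ideal.span {a ^ n}) → u ∈ J := by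
      rintro J hJ _ ⟨a, ha, rfl⟩
      exact hcl J hJ a ha
    have hMap : ∀ {L : List S}, (Ideal.ofList L).radical = maximalIdeal S →
        ∀ s ∈ L.map φ, s ∈ φ '' maximalIdeal S := fun hL s hs => by
      obtain ⟨t, ht, rfl⟩ := List.mem_map.1 hs
      exact ⟨t, hmem hL t ht, rfl⟩
    have h1 : WeaklyRegularMod ⊥ ((Z ++ [z] ++ X).map φ) := by
      refine WeaklyRegularMod.perm hT ((hperm X).map φ) Submodule.fg_bot (fun s hs => ?_)
        (h.replace_last φ hz₁ haM)
      exact hMap (hrad hz₁) s (((hperm X).map φ).mem_iff.1 hs)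
    have h2 := ih (Z := Z ++ [z]) hX hY (by rw [← hZ]; simp; ring) (by
      simp only [List.mem_append, List.mem_singleton]
      rintro s (hs | rfl)
      exacts [hZm s hs, hz]) (hrad hz₁) (hrad hz₂) h1
    refine WeaklyRegularMod.replace_last φ hYm' hz ?_
    exact WeaklyRegularMod.perm hT ((hperm Y).symm.map φ) Submodule.fg_bot (hMap (hrad hz₂)) h2

/-- An `S`-algebra in which finitely generated ideals are closed for the topology of the maximal
ideal and which is Cohen-Macaulay with respect to one system of parameters is big
Cohen-Macaulay. -/
theorem IsCMwrt.isBigCM {d : ℕ} {x : Fin d → S} (hx : IsSOP S x) (h : IsCMwrt φ x)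
    (hcl : ∀ J : Ideal B, J.FG → ∀ a ∈ maximalIdeal S, ∀ u,
      (∀ n, u ∈ J ⊔ Ideal.span {φ a ^ n}) → u ∈ J) : IsBigCM φ := by
  intro d' y hy
  obtain rfl : d = d' := by
    have := hx.1.trans hy.1.symm
    exact_mod_cast this
  have hmap : ∀ z : Fin d → S, List.ofFn (fun i => φ (z i)) = (List.ofFn z).map φ := fun z => by
    rw [List.map_ofFn]; rfl
  rw [IsCMwrt, isRegSeq_iff, hmap] at h ⊢
  refine ⟨?_, fun htop => h.2 ?_⟩
  · refine WeaklyRegularMod.exchange φ hcl d (Z := []) (X := List.ofFn x) (Y := List.ofFn y)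
      (by simp) (by simp) (by simpa using hx.1) (by simp) ?_ ?_ h.1
    · rw [List.nil_append, ofList_ofFn, hx.2.2]
    · rw [List.nil_append, ofList_ofFn, hy.2.2]
  · rw [← Ideal.radical_eq_top, eq_top_iff, ← htop, Ideal.span_le]
    rintro _ ⟨i, rfl⟩
    obtain ⟨n, hn⟩ := hx.2.2.ge (hy.2.1 i)
    refine ⟨n, ?_⟩
    have := Ideal.mem_map_of_mem φ hn
    rwa [map_pow, Ideal.map_span, ← Set.range_comp] at this

end Exchange

section FilterProduct

theorem span_range_pow_antitone {B κ : Type*} [CommRing B] (y : κ → B) :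
    Antitone fun n => Ideal.span (Set.range fun j => y j ^ n) := by
  intro m n hmn
  rw [Ideal.span_le]
  rintro _ ⟨j, rfl⟩
  exact Ideal.pow_mem_of_pow_mem _ (Ideal.subset_span ⟨j, rfl⟩) hmn

theorem cancel_mod_pow {B : Type*} [CommRing B] {m : ℕ} (n : ℕ) {y : Fin m → B} {J : Ideal B}
    (h : WeaklyRegularMod J (List.ofFn y)) (i : Fin m) (u : B)
    (hu : y i * u ∈ J ⊔ Ideal.span (y '' {j | j < i}) ⊔
      Ideal.span (Set.range fun j => y j ^ (n + 1))) :
    u ∈ J ⊔ Ideal.span (y '' {j | j < i}) ⊔ Ideal.span (Set.range fun j => y j ^ n) := by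
  induction m generalizing J with
  | zero => exact i.elim0
  | succ m ih =>
    have hsplit : ∀ k, Ideal.span (Set.range fun j => y j ^ k) =
        Ideal.span {y 0 ^ k} ⊔ Ideal.span (Set.range fun j : Fin m => y j.succ ^ k) := fun k => by
      rw [Fin.range_fin_succ, Ideal.span_insert]; rfl
    rw [List.ofFn_succ] at h
    rw [hsplit] at hu ⊢
    induction i using Fin.cases with
    | zero =>
      have hlist : Ideal.span (Set.range fun j : Fin m => y j.succ ^ (n + 1)) =
          Ideal.ofList ((List.ofFn fun j => y j.succ).map (· ^ (n + 1))) := by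
        rw [List.map_ofFn, ofList_ofFn]; rfl
      simp only [not_lt_zero, Set.ofPred_false, Set.image_empty, Ideal.span_empty, sup_bot_eq]
        at hu ⊢
      rw [← sup_assoc, sup_right_comm] at hu ⊢
      obtain ⟨w, hw⟩ := mem_sup_span_singleton_iff.1 hu
      refine mem_sup_span_singleton_iff.2 ⟨w, ?_⟩
      rw [pow_succ', mul_assoc, ← mul_sub, hlist] at hw
      have h' : WeaklyRegularMod J (y 0 :: (List.ofFn fun j => y j.succ).map (· ^ (n + 1))) :=
        ⟨h.1, h.2.map_pow (n + 1)⟩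
      refine sup_le_sup_left ?_ J (h'.cancel_mod_ofList _ hw)
      exact hlist.ge.trans (span_range_pow_antitone _ n.le_succ)
    | succ i =>
      rw [image_setOf_lt_succ] at hu ⊢
      have hle : J ⊔ (Ideal.span {y 0} ⊔ Ideal.span ((fun j : Fin m => y j.succ) '' {j | j < i})) ⊔
          (Ideal.span {y 0 ^ (n + 1)} ⊔
            Ideal.span (Set.range fun j : Fin m => y j.succ ^ (n + 1))) ≤
          J ⊔ Ideal.span {y 0} ⊔ Ideal.span ((fun j : Fin m => y j.succ) '' {j | j < i}) ⊔
            Ideal.span (Set.range fun j : Fin m => y j.succ ^ (n + 1)) := by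
        rw [← sup_assoc J]
        refine sup_le le_sup_left (sup_le ?_ le_sup_right)
        refine le_sup_of_le_left (le_sup_of_le_left (le_sup_of_le_right ?_))
        rw [Ideal.span_singleton_le_span_singleton]
        exact dvd_pow_self _ n.succ_ne_zero
      have hle' : J ⊔ Ideal.span {y 0} ⊔ Ideal.span ((fun j : Fin m => y j.succ) '' {j | j < i}) ⊔
            Ideal.span (Set.range fun j : Fin m => y j.succ ^ n) ≤
          J ⊔ (Ideal.span {y 0} ⊔ Ideal.span ((fun j : Fin m => y j.succ) '' {j | j < i})) ⊔
          (Ideal.span {y 0 ^ n} ⊔ Ideal.span (Set.range fun j : Fin m => y j.succ ^ n)) := by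
        rw [← sup_assoc J]
        exact sup_le_sup_left le_sup_right _
      exact hle' (ih h.2 i (hle hu))

/-- The `S`-algebra `C` is a perfect ring of characteristic exponent `p`, it is Cohen-Macaulay with
respect to `x`, and its finitely generated ideals are closed for the `(x)`-adic topology. -/
structure IsPerfectClosedCM {S C : Type*} [CommRing S] [CommRing C] (p : ℕ) (φ : S →+* C)
    {d : ℕ} (x : Fin d → S) : Prop where
  bijective_pow : Function.Bijective fun c : C => c ^ p
  isCMwrt : IsCMwrt φ x
  closed : ∀ J : Ideal C, J.FG → ∀ u,
    (∀ n, u ∈ J ⊔ Ideal.span (Set.range fun j => φ (x j) ^ n)) → u ∈ J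

theorem exists_tendsto_forall {ι : Type*} {F : Filter ι} {h : ι → ℕ}
    (hh : Filter.Tendsto h F Filter.atTop) {P : ι → ℕ → Prop} (h0 : ∀ i, P i 0)
    (hP : ∀ n, ∀ᶠ i in F, P i n) :
    ∃ N : ι → ℕ, Filter.Tendsto N F Filter.atTop ∧ ∀ i, P i (N i) := by
  classical
  refine ⟨fun i => Nat.findGreatest (P i) (h i), Filter.tendsto_atTop.2 fun n => ?_,
    fun i => Nat.findGreatest_spec (Nat.zero_le _) (h0 i)⟩
  filter_upwards [hP n, Filter.tendsto_atTop.1 hh n] with i hi hn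
  exact Nat.le_findGreatest hn hi

theorem mem_span_range_pi_iff {ι κ : Type*} [Fintype κ] {C : ι → Type*} [∀ i, CommRing (C i)]
    (y : κ → ∀ i, C i) (f : ∀ i, C i) :
    f ∈ Ideal.span (Set.range y) ↔ ∀ i, f i ∈ Ideal.span (Set.range fun j => y j i) := by
  simp only [Ideal.mem_span_range_iff_exists_fun]
  constructor
  · rintro ⟨c, rfl⟩ i
    exact ⟨fun j => c j i, by simp⟩
  · intro h
    choose c hc using h
    exact ⟨fun j i => c i j, by ext i; simp [← hc]⟩

theorem mem_span_range_mk_iff {A κ : Type*} [CommRing A] (K : Ideal A) (y : κ → A) (f : A) :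
    Ideal.Quotient.mk K f ∈ Ideal.span (Set.range fun j => Ideal.Quotient.mk K (y j)) ↔
      ∃ k ∈ K, f - k ∈ Ideal.span (Set.range y) := by
  have : (Set.range fun j => Ideal.Quotient.mk K (y j)) = Ideal.Quotient.mk K '' Set.range y :=
    Set.range_comp _ _
  rw [this, ← Ideal.map_span, ← Ideal.mem_comap,
    Ideal.comap_map_of_surjective' _ Ideal.Quotient.mk_surjective, Ideal.mk_ker]
  constructor
  · intro h
    obtain ⟨a, ha, k, hk, rfl⟩ := Submodule.mem_sup.1 h
    exact ⟨k, hk, by simpa using ha⟩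
  · rintro ⟨k, hk, h⟩
    rw [← sub_add_cancel f k]
    exact Submodule.add_mem_sup h hk

variable {S : Type*} [CommRing S] {d : ℕ} (x : Fin d → S) {ι : Type*} (F : Filter ι)
  {C : ι → Type*} [∀ i, CommRing (C i)] (φ : ∀ i, S →+* C i)

/-- The families that tend to zero along `F` for the `(x)`-adic topologies. -/
def nearZero : Ideal (∀ i, C i) where
  carrier := {f | ∀ n, ∀ᶠ i in F, f i ∈ Ideal.span (Set.range fun j => φ i (x j) ^ n)}
  zero_mem' _ := Filter.Eventually.of_forall fun _ => Ideal.zero_mem _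
  add_mem' ha hb n := by
    filter_upwards [ha n, hb n] with i hi hi'
    exact Ideal.add_mem _ hi hi'
  smul_mem' c f hf n := by
    filter_upwards [hf n] with i hi
    exact Ideal.mul_mem_left _ _ hi

variable {F}

theorem mk_mem_span_range_iff {h : ι → ℕ} (hh : Filter.Tendsto h F Filter.atTop)
    {κ : Type*} [Fintype κ] (y : κ → ∀ i, C i) (f : ∀ i, C i) :
    Ideal.Quotient.mk (nearZero x F φ) f ∈
        Ideal.span (Set.range fun j => Ideal.Quotient.mk (nearZero x F φ) (y j)) ↔
      ∀ n, ∀ᶠ i in F, f i ∈ Ideal.span (Set.range fun j => y j i) ⊔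
        Ideal.span (Set.range fun j => φ i (x j) ^ n) := by
  rw [mem_span_range_mk_iff]
  simp only [mem_span_range_pi_iff]
  constructor
  · rintro ⟨k, hk, hf⟩ n
    filter_upwards [hk n] with i hi
    rw [← sub_add_cancel (f i) (k i)]
    exact Submodule.add_mem_sup (hf i) hi
  · intro hf
    obtain ⟨N, hN, hNf⟩ := exists_tendsto_forall hh (P := fun i n => n = 0 ∨
      f i ∈ Ideal.span (Set.range fun j => y j i) ⊔
        Ideal.span (Set.range fun j => φ i (x j) ^ n)) (fun _ => Or.inl rfl)
      (fun n => (hf n).mono fun _ => Or.inr)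
    have key : ∀ i, ∃ k, f i - k ∈ Ideal.span (Set.range fun j => y j i) ∧
        (N i = 0 ∨ k ∈ Ideal.span (Set.range fun j => φ i (x j) ^ N i)) := by
      intro i
      rcases hNf i with h0 | hi
      · exact ⟨f i, by simp, Or.inl h0⟩
      · obtain ⟨a, ha, k, hk, hak⟩ := Submodule.mem_sup.1 hi
        exact ⟨k, by rwa [← hak, add_sub_cancel_right], Or.inr hk⟩
    choose k hk hkN using key
    refine ⟨k, fun n => ?_, hk⟩
    filter_upwards [Filter.tendsto_atTop.1 hN (n + 1)] with i hi
    exact span_range_pow_antitone _ (by omega) ((hkN i).resolve_left (by omega))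

theorem mem_span_range_of_pow_mem {B κ : Type*} [CommRing B] [Fintype κ] {p : ℕ} [Fact p.Prime]
    [CharP B p] (hB : Function.Bijective fun c : B => c ^ p) (y : κ → B) (u : B)
    (hu : u ^ p ∈ Ideal.span (Set.range fun j => y j ^ p)) : u ∈ Ideal.span (Set.range y) := by
  obtain ⟨c, hc⟩ := Ideal.mem_span_range_iff_exists_fun.1 hu
  choose r hr using fun j => hB.2 (c j)
  refine Ideal.mem_span_range_iff_exists_fun.2 ⟨r, hB.1 ?_⟩
  simp only at hr
  simp only [sum_pow_char, mul_pow, hr, hc]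

/-- The quotient of a product of perfect algebras, each Cohen-Macaulay with respect to `x`, by the
families tending to zero. -/
theorem isPerfectClosedCM_mk_nearZero {h : ι → ℕ} (hh : Filter.Tendsto h F Filter.atTop)
    [F.NeBot] {p : ℕ} [Fact p.Prime] (hp : (p : S) = 0)
    (hfrob : ∀ i, Function.Bijective fun c : C i => c ^ p) (hcm : ∀ i, IsCMwrt (φ i) x) :
    IsPerfectClosedCM p ((Ideal.Quotient.mk (nearZero x F φ)).comp (RingHom.pi φ)) x := by
  have hpC : ∀ i, CharP (C i) p := fun i => by
    have : Nontrivial (C i) := by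
      by_contra hcon
      rw [not_nontrivial_iff_subsingleton] at hcon
      exact (hcm i).2 (Subsingleton.elim _ _)
    rw [CharP.charP_iff_prime_eq_zero Fact.out, ← map_natCast (φ i), hp, map_zero]
  have hpq : ∀ u v : ∀ i, C i, (u - v) ^ p = u ^ p - v ^ p := fun u v => by
    ext i
    exact sub_pow_char _ _
  refine ⟨⟨fun u v huv => ?_, fun u => ?_⟩, ⟨fun i u hu => ?_, fun htop => ?_⟩, fun J hJ u hu => ?_⟩
  · obtain ⟨u, rfl⟩ := Ideal.Quotient.mk_surjective u
    obtain ⟨v, rfl⟩ := Ideal.Quotient.mk_surjective v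
    simp only [← map_pow] at huv
    rw [Ideal.Quotient.eq, ← hpq] at huv
    rw [Ideal.Quotient.eq]
    intro n
    filter_upwards [huv (n * p)] with i hi
    refine mem_span_range_of_pow_mem (hfrob i) _ _ ?_
    simpa only [pow_mul, Pi.pow_apply] using hi
  · obtain ⟨u, rfl⟩ := Ideal.Quotient.mk_surjective u
    choose v hv using fun i => (hfrob i).2 (u i)
    refine ⟨Ideal.Quotient.mk _ v, ?_⟩
    simp only [← map_pow]
    exact congrArg _ (funext hv)
  · obtain ⟨u, rfl⟩ := Ideal.Quotient.mk_surjective u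
    rw [Set.image_eq_range] at hu ⊢
    simp only [RingHom.comp_apply, ← map_mul] at hu ⊢
    rw [mk_mem_span_range_iff x φ hh] at hu ⊢
    intro n
    filter_upwards [hu (n + 1)] with a ha
    have := cancel_mod_pow n ((isRegSeq_iff _).1 (hcm a)).1 i (u a)
    simp only [bot_sup_eq] at this
    rw [Set.image_eq_range] at this
    exact this ha
  · rw [Ideal.eq_top_iff_one, ← map_one (Ideal.Quotient.mk _)] at htop
    have h1 := (mk_mem_span_range_iff x φ hh (fun j => RingHom.pi φ (x j)) 1).1 htop 1
    obtain ⟨i, hi⟩ := h1.exists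
    refine (hcm i).2 ((Ideal.eq_top_iff_one _).2 ?_)
    simpa [RingHom.pi_apply] using hi
  · obtain ⟨m, y, rfl⟩ := Submodule.fg_iff_exists_fin_generating_family.1 hJ
    obtain ⟨u, rfl⟩ := Ideal.Quotient.mk_surjective u
    choose z hz using fun j => Ideal.Quotient.mk_surjective (y j)
    obtain rfl := funext hz
    refine (mk_mem_span_range_iff x φ hh z u).2 fun n => ?_
    have key : ∀ {A : Type _} [CommRing A] (f : Fin m → A) (g : Fin d → A),
        Ideal.span (Set.range f) ⊔ Ideal.span (Set.range g) =
          Ideal.span (Set.range (Sum.elim f g)) := fun f g => by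
      rw [Set.Sum.elim_range, Ideal.span_union]
    have hu' := hu n
    rw [Ideal.submodule_span_eq, key] at hu'
    have hfun : (Sum.elim (fun j => Ideal.Quotient.mk (nearZero x F φ) (z j))
        fun j => ((Ideal.Quotient.mk (nearZero x F φ)).comp (RingHom.pi φ)) (x j) ^ n) =
        fun j => Ideal.Quotient.mk (nearZero x F φ)
          (Sum.elim z (fun j => RingHom.pi φ (x j) ^ n) j) := by
      ext (j | j) <;> simp
    rw [hfun, mk_mem_span_range_iff x φ hh] at hu'
    filter_upwards [hu' n] with i hi
    refine (show Ideal.span (Set.range fun j => Sum.elim z (fun j => RingHom.pi φ (x j) ^ n) j i) ⊔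
      Ideal.span (Set.range fun j => φ i (x j) ^ n) ≤ Ideal.span (Set.range fun j => z j i) ⊔
        Ideal.span (Set.range fun j => φ i (x j) ^ n) from
      sup_le (Ideal.span_le.2 ?_) le_sup_right) hi
    rintro _ ⟨j | j, rfl⟩
    · exact Ideal.mem_sup_left (Ideal.subset_span ⟨j, rfl⟩)
    · exact Ideal.mem_sup_right (Ideal.subset_span ⟨j, rfl⟩)

end FilterProduct

section Perfection

variable {S : Type*} [CommRing S] {d : ℕ} {x : Fin d → S}

theorem IsPerfectClosedCM.isBigCM {C : Type*} [CommRing C] [IsLocalRing S] [IsNoetherianRing S]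
    {p : ℕ} {φ : S →+* C} (h : IsPerfectClosedCM p φ x) (hx : IsSOP S x) : IsBigCM φ := by
  refine h.isCMwrt.isBigCM φ hx fun J hJ a ha u hu => h.closed J hJ u fun n => ?_
  have hle : IsLocalRing.maximalIdeal S ≤ (Ideal.span (Set.range fun j => x j ^ n)).radical := by
    rw [← hx.2.2, Ideal.radical_le_radical_iff, Ideal.span_le]
    rintro _ ⟨j, rfl⟩
    exact ⟨n, Ideal.subset_span ⟨j, rfl⟩⟩
  obtain ⟨N, hN⟩ := hle ha
  have hmem := Ideal.mem_map_of_mem φ hN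
  rw [Ideal.map_span, ← Set.range_comp] at hmem
  simp only [Function.comp_def, map_pow] at hmem
  have hsup : J ⊔ Ideal.span {φ a ^ N} ≤ J ⊔ Ideal.span (Set.range fun j => φ (x j) ^ n) :=
    sup_le_sup_left ((Ideal.span_singleton_le_iff_mem _).2 hmem) J
  exact hsup (hu N)

theorem IsCMwrt.nontrivial {B : Type*} [CommRing B] {φ : S →+* B} (h : IsCMwrt φ x) :
    Nontrivial B := by
  by_contra hcon
  rw [not_nontrivial_iff_subsingleton] at hcon
  exact h.2 (Subsingleton.elim _ _)

theorem IsCMwrt.charP {B : Type*} [CommRing B] {φ : S →+* B} (h : IsCMwrt φ x) {p : ℕ}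
    [Fact p.Prime] (hp : (p : S) = 0) : CharP B p := by
  have := h.nontrivial
  rw [CharP.charP_iff_prime_eq_zero Fact.out, ← map_natCast φ, hp, map_zero]

theorem pow_mem_span_range_pow {B κ : Type*} [CommRing B] {p : ℕ} [Fact p.Prime] [CharP B p]
    (n : ℕ) {y : κ → B} {b : B} (hb : b ∈ Ideal.span (Set.range y)) :
    b ^ p ^ n ∈ Ideal.span (Set.range fun j => y j ^ p ^ n) := by
  have := Ideal.mem_map_of_mem (iterateFrobenius B p n) hb
  rw [Ideal.map_span, ← Set.range_comp] at this
  exact this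

theorem mem_span_range_of_pow_pow_mem {B κ : Type*} [CommRing B] [Fintype κ] {p : ℕ}
    [Fact p.Prime] [CharP B p] (hB : Function.Bijective fun c : B => c ^ p) (n : ℕ) {y : κ → B}
    {u : B} (hu : u ^ p ^ n ∈ Ideal.span (Set.range fun j => y j ^ p ^ n)) :
    u ∈ Ideal.span (Set.range y) := by
  induction n with
  | zero => simpa using hu
  | succ n ih =>
    refine ih (mem_span_range_of_pow_mem hB _ _ ?_)
    simpa only [pow_succ, pow_mul] using hu

theorem mk_mem_span_range_of_iff {B κ : Type*} [CommRing B] [Fintype κ] {p : ℕ}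
    [Fact p.Prime] [CharP B p] (y : κ → B) (m : ℕ) (b : B) :
    PerfectClosure.mk B p (m, b) ∈ Ideal.span (Set.range fun j => PerfectClosure.of B p (y j)) ↔
      ∃ k, b ^ p ^ k ∈ Ideal.span (Set.range fun j => y j ^ p ^ (m + k)) := by
  constructor
  · intro h
    have key : ∀ z ∈ Ideal.span (Set.range fun j => PerfectClosure.of B p (y j)),
        ∃ n c, z = PerfectClosure.mk B p (n, c) ∧
          c ∈ Ideal.span (Set.range fun j => y j ^ p ^ n) := by
      intro z hz
      induction hz using Submodule.span_induction with
      | mem z hz =>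
        obtain ⟨j, rfl⟩ := hz
        exact ⟨0, y j, rfl, Ideal.subset_span ⟨j, by simp⟩⟩
      | zero => exact ⟨0, 0, rfl, Ideal.zero_mem _⟩
      | add z w _ _ hz hw =>
        obtain ⟨n, c, rfl, hc⟩ := hz
        obtain ⟨n', c', rfl, hc'⟩ := hw
        refine ⟨n + n', _, PerfectClosure.mk_add_mk _ _ _ _, ?_⟩
        simp only [iterate_frobenius]
        refine Ideal.add_mem _ ?_ ?_
        · simpa only [pow_add, pow_mul] using pow_mem_span_range_pow n' hc
        · simpa only [add_comm n, pow_add, pow_mul] using pow_mem_span_range_pow n hc'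
      | smul r z _ hz =>
        obtain ⟨n, c, rfl, hc⟩ := hz
        obtain ⟨⟨n', r⟩, rfl⟩ := PerfectClosure.mk_surjective B p r
        refine ⟨n' + n, _, PerfectClosure.mk_mul_mk _ _ _ _, ?_⟩
        simp only [iterate_frobenius]
        refine Ideal.mul_mem_left _ _ ?_
        simpa only [add_comm n', pow_add, pow_mul] using pow_mem_span_range_pow n' hc
    obtain ⟨n, c, hbc, hc⟩ := key _ h
    obtain ⟨k, hk⟩ := (PerfectClosure.mk_eq_iff _ _ _ _).1 hbc
    simp only [iterate_frobenius] at hk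
    refine ⟨n + k, ?_⟩
    rw [hk, show m + (n + k) = n + (m + k) by ring]
    simpa only [pow_add, pow_mul] using pow_mem_span_range_pow (m + k) hc
  · rintro ⟨k, hk⟩
    refine mem_span_range_of_pow_pow_mem (PerfectRing.bijective_frobenius) (m + k) ?_
    have hpow : PerfectClosure.mk B p (m, b) ^ p ^ (m + k) =
        PerfectClosure.of B p (b ^ p ^ k) := by
      have hm : PerfectClosure.mk B p (m, b) ^ p ^ m = PerfectClosure.of B p b := by
        rw [← iterate_frobenius, PerfectClosure.iterate_frobenius_mk]
      rw [pow_add, pow_mul, hm, map_pow]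
    have := Ideal.mem_map_of_mem (PerfectClosure.of B p) hk
    rw [Ideal.map_span, ← Set.range_comp] at this
    rw [hpow]
    simpa only [Function.comp_def, map_pow] using this

theorem IsCMwrt.perfectClosure {B : Type*} [CommRing B] {φ : S →+* B} (h : IsCMwrt φ x) {p : ℕ}
    [Fact p.Prime] [CharP B p] : IsCMwrt ((PerfectClosure.of B p).comp φ) x := by
  have hreg := (isRegSeq_iff _).1 h
  refine ⟨fun i u hu => ?_, fun htop => h.2 ?_⟩
  · obtain ⟨⟨m, b⟩, rfl⟩ := PerfectClosure.mk_surjective B p u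
    rw [Set.image_eq_range] at hu ⊢
    simp only [RingHom.comp_apply] at hu ⊢
    rw [PerfectClosure.of_apply, PerfectClosure.mk_mul_mk] at hu
    rw [mk_mem_span_range_of_iff]
    obtain ⟨k, hk⟩ := (mk_mem_span_range_of_iff _ _ _).1 hu
    refine ⟨k, ?_⟩
    have hpow := hreg.1.map_pow (p ^ (m + k))
    rw [List.map_ofFn, weaklyRegularMod_ofFn] at hpow
    have := hpow i (b ^ p ^ k)
    simp only [bot_sup_eq] at this
    rw [Set.image_eq_range] at this
    refine this ?_
    simp only [iterate_frobenius, zero_add, mul_pow, ← pow_mul, ← pow_add] at hk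
    exact hk
  · rw [Ideal.eq_top_iff_one, PerfectClosure.one_def] at htop
    simp only [RingHom.comp_apply] at htop
    obtain ⟨k, hk⟩ := (mk_mem_span_range_of_iff _ _ _).1 htop
    rw [one_pow] at hk
    rw [Ideal.eq_top_iff_one]
    have := span_range_pow_antitone (fun j => φ (x j))
      (Nat.one_le_pow (0 + k) p (Fact.out : p.Prime).pos) hk
    simpa using this

end Perfection

section AlmostCM

universe u

variable {S : Type*} [CommRing S] {d : ℕ} {x : Fin d → S}

theorem root_pow_pow {D : Type*} [CommRing D] {p : ℕ} {π : ℕ → D} (hπ : ∀ e, π (e + 1) ^ p = π e)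
    (e n : ℕ) : π (e + n) ^ p ^ n = π e := by
  induction n with
  | zero => simp
  | succ n ih => rw [pow_succ', pow_mul, ← add_assoc, hπ, ih]

theorem algebraMap_away_mem_span_range_iff {D κ : Type*} [CommRing D] [Fintype κ] (π : ℕ → D)
    (y : κ → D) (f : ℕ → D) :
    algebraMap (ℕ → D) (Localization.Away π) f ∈ Ideal.span (Set.range fun j =>
        algebraMap (ℕ → D) (Localization.Away π) (Function.const ℕ (y j))) ↔
      ∃ N, ∀ e, π e ^ N * f e ∈ Ideal.span (Set.range y) := by
  have : (Set.range fun j => algebraMap (ℕ → D) (Localization.Away π) (Function.const ℕ (y j))) =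
      algebraMap (ℕ → D) (Localization.Away π) '' Set.range fun j => Function.const ℕ (y j) :=
    Set.range_comp _ _
  rw [this, ← Ideal.map_span,
    IsLocalization.algebraMap_mem_map_algebraMap_iff (Submonoid.powers π)]
  simp [Submonoid.mem_powers_iff, mem_span_range_pi_iff]

/-- An almost Cohen-Macaulay algebra becomes Cohen-Macaulay after inverting the sequence of roots
in the ring of all sequences. -/
theorem IsAlmostCMwrt.isCMwrt_away {D : Type*} [CommRing D] {p : ℕ} (hp : 1 < p) {φ : S →+* D}
    {π : ℕ → D} (hπ : ∀ e, π (e + 1) ^ p = π e) (h : IsAlmostCMwrt φ π x) :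
    IsCMwrt ((algebraMap (ℕ → D) (Localization.Away π)).comp (RingHom.pi fun _ => φ)) x := by
  refine ⟨fun i u hu => ?_, fun htop => h.2 ?_⟩
  · obtain ⟨⟨f, s⟩, hf⟩ := IsLocalization.surj (Submonoid.powers π) u
    have hs := IsLocalization.map_units (Localization.Away π) s
    simp only at hf
    rw [Set.image_eq_range] at hu ⊢
    rw [← Ideal.mul_unit_mem_iff_mem _ hs, mul_assoc, hf] at hu
    simp only [RingHom.comp_apply, ← map_mul] at hu
    rw [← Ideal.mul_unit_mem_iff_mem _ hs, hf]
    obtain ⟨N, hN⟩ := (algebraMap_away_mem_span_range_iff π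
      (fun j : {j | j < i} => φ (x j)) _).1 hu
    refine (algebraMap_away_mem_span_range_iff π (fun j : {j | j < i} => φ (x j)) _).2
      ⟨N + 1, fun e => ?_⟩
    have := h.1 i (π e ^ N * f e)
    rw [Set.image_eq_range] at this
    rw [pow_succ', mul_assoc]
    refine this ?_ e
    convert hN e using 1
    simp only [Pi.mul_apply, RingHom.pi_apply]
    ring
  · rw [Ideal.eq_top_iff_one, ← map_one (algebraMap (ℕ → D) (Localization.Away π))] at htop
    obtain ⟨N, hN⟩ := (algebraMap_away_mem_span_range_iff π (fun j => φ (x j)) 1).1 htop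
    rw [Ideal.span_le]
    rintro _ ⟨e, rfl⟩
    have := hN (e + N)
    rw [Pi.one_apply, mul_one] at this
    rw [← root_pow_pow hπ e N]
    exact Ideal.pow_mem_of_pow_mem _ this (Nat.lt_pow_self hp).le

theorem IsAlmostCMwrt.exists_isPerfectClosedCM {D : Type u} [CommRing D] {p : ℕ} [Fact p.Prime]
    (hp : (p : S) = 0) {φ : S →+* D} {π : ℕ → D} (hπ : ∀ e, π (e + 1) ^ p = π e)
    (h : IsAlmostCMwrt φ π x) :
    ∃ (C : Type u) (_ : CommRing C) (g : D →+* C), IsPerfectClosedCM p (g.comp φ) x := by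
  have hB := h.isCMwrt_away (Fact.out : p.Prime).one_lt hπ
  have := hB.charP hp
  have hP := hB.perfectClosure (p := p)
  refine ⟨_, _, (Ideal.Quotient.mk _).comp (RingHom.pi fun _ : ℕ =>
    (PerfectClosure.of (Localization.Away π) p).comp
      ((algebraMap (ℕ → D) _).comp (RingHom.pi fun _ => RingHom.id D))),
    isPerfectClosedCM_mk_nearZero x (fun _ => _) (Filter.tendsto_id (x := Filter.atTop)) hp
      (fun _ => PerfectRing.bijective_frobenius) fun _ => hP⟩

/-- Any nonzero element of a perfect, closed Cohen-Macaulay algebra can be made a nonzerodivisor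
in the sense that its annihilator is killed by a map to another such algebra. -/
theorem IsPerfectClosedCM.exists_kill_annihilator {C : Type u} [CommRing C] {p : ℕ} [Fact p.Prime]
    (hp : (p : S) = 0) {φ : S →+* C} (h : IsPerfectClosedCM p φ x) {b : C} (hb : b ≠ 0) :
    ∃ (C' : Type u) (_ : CommRing C') (g : C →+* C'),
      IsPerfectClosedCM p (g.comp φ) x ∧ ∀ c, b * c = 0 → g c = 0 := by
  have hp0 := (Fact.out : p.Prime).ne_zero
  let r : C → C := Function.surjInv h.bijective_pow.2
  have hr : ∀ c, r c ^ p = c := Function.surjInv_eq h.bijective_pow.2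
  let β : ℕ → C := fun e => r^[e] b
  have hβ : ∀ e, β (e + 1) ^ p = β e := fun e => by
    simp only [β, Function.iterate_succ_apply', hr]
  let K : Ideal C := Ideal.torsionOf C C b
  have hK : ∀ c, c ∈ K ↔ c * b = 0 := fun c => Ideal.mem_torsionOf_iff b c
  have hβK : ∀ c ∈ K, ∀ e, β e * c = 0 := by
    intro c hc e
    induction e with
    | zero => rw [mul_comm]; exact (hK c).1 hc
    | succ e ih =>
      refine h.bijective_pow.1 ?_
      simp only [mul_pow, hβ, zero_pow hp0]
      rw [← Nat.sub_one_add_one hp0, pow_succ', ← mul_assoc, ih, zero_mul]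
  have halmost : IsAlmostCMwrt ((Ideal.Quotient.mk K).comp φ) (fun e => Ideal.Quotient.mk K (β e))
      x := by
    refine ⟨fun i u hu e => ?_, fun hle => hb ?_⟩
    · obtain ⟨u, rfl⟩ := Ideal.Quotient.mk_surjective u
      have hcm := h.isCMwrt.1 i (β e * u)
      rw [Set.image_eq_range] at hu ⊢ hcm
      simp only [RingHom.comp_apply, ← map_mul, mem_span_range_mk_iff] at hu ⊢
      obtain ⟨k, hk, hku⟩ := hu
      refine ⟨0, K.zero_mem, ?_⟩
      rw [sub_zero]
      refine hcm ?_
      rw [show φ (x i) * (β e * u) = β e * (φ (x i) * u - k) + β e * k by ring, hβK k hk, add_zero]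
      exact Ideal.mul_mem_left _ _ hku
    · have hmem : ∀ e, β e ∈ Ideal.span (Set.range fun j => φ (x j)) := by
        intro e
        have := hle (Ideal.subset_span ⟨e + 1, rfl⟩)
        simp only [RingHom.comp_apply, mem_span_range_mk_iff] at this
        obtain ⟨k, hk, hku⟩ := this
        rw [← hβ]
        refine Ideal.pow_mem_of_pow_mem _ (m := 2) ?_ (Fact.out : p.Prime).two_le
        rw [show β (e + 1) ^ 2 = β (e + 1) * (β (e + 1) - k) + β (e + 1) * k by ring,
          hβK k hk, add_zero]
        exact Ideal.mul_mem_left _ _ hku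
      have := h.isCMwrt.charP hp
      refine Ideal.mem_bot.1 (h.closed ⊥ Submodule.fg_bot b fun n => ?_)
      rw [bot_sup_eq]
      have hn := pow_mem_span_range_pow (p := p) n (hmem n)
      have hb' := root_pow_pow hβ 0 n
      rw [zero_add] at hb'
      rw [hb'] at hn
      exact span_range_pow_antitone _ (Nat.lt_pow_self (Fact.out : p.Prime).one_lt).le hn
  obtain ⟨C', _, g, hg⟩ := halmost.exists_isPerfectClosedCM hp
    (fun e => by rw [← map_pow, hβ])
  refine ⟨C', _, g.comp (Ideal.Quotient.mk K), hg, fun c hc => ?_⟩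
  rw [RingHom.comp_apply, Ideal.Quotient.eq_zero_iff_mem.2 ((hK c).2 (mul_comm b c ▸ hc)), map_zero]

end AlmostCM

section Domain

universe u

theorem exists_notMem_mul_eq_zero_of_mem_minimalPrimes {C : Type*} [CommRing C] [IsReduced C]
    {P : Ideal C} (hP : P ∈ minimalPrimes C) {a : C} (ha : a ∈ P) : ∃ b ∉ P, b * a = 0 := by
  have hprime : P.IsPrime := hP.1.1
  by_contra! hcon
  have hdisj : Disjoint ((⊥ : Ideal C) : Set C)
      (P.primeCompl ⊔ Submonoid.powers a : Submonoid C) := by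
    rw [Set.disjoint_left]
    rintro c hc hmem
    obtain rfl : c = 0 := hc
    obtain ⟨b, hb, _, ⟨n, rfl⟩, hbn⟩ := Submonoid.mem_sup.1 hmem
    refine hcon b hb (IsReduced.eq_zero _ ⟨n + 1, ?_⟩)
    rw [show (b * a) ^ (n + 1) = (b * a ^ n) * (b ^ n * a) by ring]
    simp only at hbn
    rw [hbn, zero_mul]
  obtain ⟨Q, hQ, -, hQd⟩ := Ideal.exists_le_prime_disjoint _ _ hdisj
  have hQP : Q ≤ P := fun c hc => by
    by_contra hcP
    exact Set.disjoint_left.1 hQd hc (Submonoid.mem_sup_left hcP)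
  exact Set.disjoint_left.1 hQd (hP.2 ⟨hQ, bot_le⟩ hQP ha)
    (Submonoid.mem_sup_right (Submonoid.mem_powers a))

variable {S : Type*} [CommRing S] {d : ℕ} {x : Fin d → S}

theorem IsPerfectClosedCM.exists_kill_zeroDivisors {C : Type u} [CommRing C] {p : ℕ}
    [Fact p.Prime] (hp : (p : S) = 0) {φ : S →+* C} (h : IsPerfectClosedCM p φ x) :
    ∃ (C' : Type u) (_ : CommRing C') (g : C →+* C'),
      IsPerfectClosedCM p (g.comp φ) x ∧ ∀ a b, a * b = 0 → g a = 0 ∨ g b = 0 := by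
  classical
  have := h.isCMwrt.nontrivial
  have hred : IsReduced C := isReduced_iff_pow_one_lt p (Fact.out : p.Prime).one_lt |>.2
    fun c hc => h.bijective_pow.1 (by simp [hc, (Fact.out : p.Prime).ne_zero])
  obtain ⟨P, hP⟩ : (minimalPrimes C).Nonempty := 
    Set.nonempty_coe_sort.1 (Ideal.nonempty_minimalPrimes bot_ne_top)
  have hprime : P.IsPrime := hP.1.1
  choose β hβP hβ using fun a : P => exists_notMem_mul_eq_zero_of_mem_minimalPrimes hP a.2
  have hprod : ∀ T : Finset P, ∏ a ∈ T, β a ≠ 0 := fun T h0 => by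
    have := h0 ▸ P.zero_mem
    obtain ⟨a, -, ha⟩ := hprime.prod_mem_iff.1 this
    exact hβP a ha
  choose C' hC' g hg hgk using fun T : Finset P => h.exists_kill_annihilator hp (hprod T)
  have hsnd : Filter.Tendsto (Prod.snd : Finset P × ℕ → ℕ) Filter.atTop Filter.atTop := by
    rw [← Filter.prod_atTop_atTop_eq]
    exact Filter.tendsto_snd
  have key := isPerfectClosedCM_mk_nearZero x (fun i : Finset P × ℕ => (g i.1).comp φ) hsnd hp
    (fun i => (hg i.1).bijective_pow) fun i => (hg i.1).isCMwrt
  let γ : C →+* _ := (Ideal.Quotient.mk (nearZero x Filter.atTop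
    fun i : Finset P × ℕ => (g i.1).comp φ)).comp (RingHom.pi fun i : Finset P × ℕ => g i.1)
  have hγ : ∀ a ∈ P, γ a = 0 := by
    intro a ha
    refine Ideal.Quotient.eq_zero_iff_mem.2 fun n => ?_
    filter_upwards [Filter.eventually_ge_atTop ({⟨a, ha⟩}, 0)] with i hi
    have hmem : ⟨a, ha⟩ ∈ i.1 := hi.1 (Finset.mem_singleton_self _)
    rw [RingHom.pi_apply, hgk i.1 a]
    · exact Ideal.zero_mem _
    · rw [← Finset.prod_erase_mul _ _ hmem, mul_assoc, hβ ⟨a, ha⟩, mul_zero]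
  refine ⟨_, _, γ, key, fun a b hab => ?_⟩
  exact (hprime.mem_or_mem (hab ▸ P.zero_mem : a * b ∈ P)).imp (hγ a) (hγ b)

open CategoryTheory Limits in
/-- The colimit of a sequence of commutative rings. -/
theorem exists_sequential_colimit {C : ℕ → Type} [∀ n, CommRing (C n)]
    (t : ∀ n, C n →+* C (n + 1)) :
    ∃ (L : Type) (_ : CommRing L) (ι : ∀ n, C n →+* L) (ρ : ∀ m n, m ≤ n → C m →+* C n),
      (∀ n, ρ n (n + 1) n.le_succ = t n) ∧
      (∀ n, ρ n n le_rfl = RingHom.id _) ∧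
      (∀ l m n (h₁ : l ≤ m) (h₂ : m ≤ n), (ρ m n h₂).comp (ρ l m h₁) = ρ l n (h₁.trans h₂)) ∧
      (∀ m n h, (ι n).comp (ρ m n h) = ι m) ∧
      (∀ z, ∃ n c, ι n c = z) ∧
      ∀ n c, ι n c = 0 → ∃ m h, ρ n m h c = 0 := by
  let F : ℕ ⥤ CommRingCat.{0} := Functor.ofSequence (X := fun n => CommRingCat.of (C n))
    fun n => CommRingCat.ofHom (t n)
  refine ⟨(colimit F : CommRingCat.{0}), inferInstance, fun n => (colimit.ι F n).hom,
    fun m n h => (F.map (homOfLE h)).hom, fun n => ?_, fun n => ?_, fun l m n h₁ h₂ => ?_,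
    fun m n h => ?_, fun z => ?_, fun n c hc => ?_⟩
  · exact congrArg CommRingCat.Hom.hom (Functor.ofSequence_map_homOfLE_succ
      (fun n => CommRingCat.ofHom (t n)) n)
  · exact congrArg CommRingCat.Hom.hom (F.map_id n)
  · exact congrArg CommRingCat.Hom.hom (F.map_comp (homOfLE h₁) (homOfLE h₂)).symm
  · exact congrArg CommRingCat.Hom.hom (colimit.w F (homOfLE h))
  · exact Concrete.colimit_exists_rep F z
  · obtain ⟨m, f, f', hm⟩ := (Concrete.colimit_rep_eq_iff_exists F (i := n) (j := n) c 0).1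
      (hc.trans (map_zero (colimit.ι F n).hom).symm)
    refine ⟨m, leOfHom f, ?_⟩
    exact hm.trans (map_zero (F.map f').hom)

section Colimit

variable {C : ℕ → Type*} [∀ n, CommRing (C n)] {L : Type*} [CommRing L] {ι : ∀ n, C n →+* L}
  {ρ : ∀ m n, m ≤ n → C m →+* C n} {φ : ∀ n, S →+* C n} {ψ : S →+* L}

theorem map_mem_span_range {A B κ : Type*} [CommRing A] [CommRing B] (f : A →+* B) {φ : S →+* A}
    {y : κ → S} {c : A} (hc : c ∈ Ideal.span (Set.range fun j => φ (y j))) :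
    f c ∈ Ideal.span (Set.range fun j => f.comp φ (y j)) := by
  have := Ideal.mem_map_of_mem f hc
  rwa [Ideal.map_span, ← Set.range_comp] at this

theorem exists_mem_span_range_of_colimit (hι : ∀ m n h, (ι n).comp (ρ m n h) = ι m)
    (hL : ∀ z, ∃ n c, ι n c = z) (hρφ : ∀ m n h, (ρ m n h).comp (φ m) = φ n)
    (hφ : ∀ n, (ι n).comp (φ n) = ψ) {κ : Type*} (y : κ → S) {z : L}
    (hz : z ∈ Ideal.span (Set.range fun j => ψ (y j))) :
    ∃ n, ∃ c ∈ Ideal.span (Set.range fun j => φ n (y j)), ι n c = z := by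
  have hmono : ∀ {m n} (h : m ≤ n) {c}, c ∈ Ideal.span (Set.range fun j => φ m (y j)) →
      ρ m n h c ∈ Ideal.span (Set.range fun j => φ n (y j)) := by
    intro m n h c hc
    simpa only [hρφ] using map_mem_span_range (ρ m n h) hc
  have hιρ : ∀ {m n} (h : m ≤ n) c, ι n (ρ m n h c) = ι m c := fun h c =>
    DFunLike.congr_fun (hι _ _ h) c
  induction hz using Submodule.span_induction with
  | mem z hz =>
    obtain ⟨j, rfl⟩ := hz
    exact ⟨0, φ 0 (y j), Ideal.subset_span ⟨j, rfl⟩, DFunLike.congr_fun (hφ 0) (y j)⟩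
  | zero => exact ⟨0, 0, Ideal.zero_mem _, map_zero _⟩
  | add z w _ _ hz hw =>
    obtain ⟨m, c, hc, rfl⟩ := hz
    obtain ⟨n, c', hc', rfl⟩ := hw
    exact ⟨max m n, _, Ideal.add_mem _ (hmono (le_max_left m n) hc) (hmono (le_max_right m n) hc'),
      by rw [map_add, hιρ, hιρ]⟩
  | smul r z _ hz =>
    obtain ⟨m, c, hc, rfl⟩ := hz
    obtain ⟨n, c', rfl⟩ := hL r
    exact ⟨max m n, _, Ideal.mul_mem_left _ (ρ n _ (le_max_right m n) c')
      (hmono (le_max_left m n) hc), by rw [map_mul, hιρ, hιρ, smul_eq_mul]⟩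

theorem isCMwrt_of_colimit (hι : ∀ m n h, (ι n).comp (ρ m n h) = ι m)
    (hρ : ∀ l m n h₁ h₂, (ρ m n h₂).comp (ρ l m h₁) = ρ l n (h₁.trans h₂))
    (hL : ∀ z, ∃ n c, ι n c = z) (h0 : ∀ n c, ι n c = 0 → ∃ m h, ρ n m h c = 0)
    (hρφ : ∀ m n h, (ρ m n h).comp (φ m) = φ n) (hφ : ∀ n, (ι n).comp (φ n) = ψ)
    (h : ∀ n, IsCMwrt (φ n) x) : IsCMwrt ψ x := by
  have hιρ : ∀ {m n} (h : m ≤ n) c, ι n (ρ m n h c) = ι m c := fun h c =>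
    DFunLike.congr_fun (hι _ _ h) c
  have hιφ : ∀ n s, ι n (φ n s) = ψ s := fun n s => DFunLike.congr_fun (hφ n) s
  have hρφ' : ∀ {m n} (h : m ≤ n) s, ρ m n h (φ m s) = φ n s := fun h s =>
    DFunLike.congr_fun (hρφ _ _ h) s
  have hdesc : ∀ {κ : Type} (y : κ → S) n c, ι n c ∈ Ideal.span (Set.range fun j => ψ (y j)) →
      ∃ m h, ρ n m h c ∈ Ideal.span (Set.range fun j => φ m (y j)) := by
    intro κ y n c hc
    obtain ⟨k, c', hc', he⟩ := exists_mem_span_range_of_colimit hι hL hρφ hφ y hc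
    obtain ⟨m, hm, hz⟩ := h0 (max n k)
      (ρ n _ (le_max_left n k) c - ρ k _ (le_max_right n k) c') (by
        rw [map_sub, hιρ, hιρ, he, sub_self])
    refine ⟨m, (le_max_left n k).trans hm, ?_⟩
    have hc : ρ n m ((le_max_left n k).trans hm) c = ρ k m ((le_max_right n k).trans hm) c' := by
      rw [← hρ n _ m (le_max_left n k) hm, ← hρ k _ m (le_max_right n k) hm, ← sub_eq_zero,
        RingHom.comp_apply, RingHom.comp_apply, ← map_sub, hz]
    rw [hc]
    have := map_mem_span_range (ρ k m ((le_max_right n k).trans hm)) hc'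
    rwa [hρφ] at this
  refine ⟨fun i u hu => ?_, fun htop => ?_⟩
  · obtain ⟨n, c, rfl⟩ := hL u
    rw [Set.image_eq_range] at hu ⊢
    beta_reduce at hu
    rw [← hιφ n (x i), ← map_mul] at hu
    obtain ⟨m, hm, hmem⟩ := hdesc (fun j : {j | j < i} => x j) n _ hu
    rw [map_mul, hρφ'] at hmem
    have hreg := (h m).1 i (ρ n m hm c)
    rw [Set.image_eq_range] at hreg
    simpa only [hφ, hιρ] using map_mem_span_range (ι m) (hreg hmem)
  · rw [Ideal.eq_top_iff_one, ← map_one (ι 0)] at htop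
    obtain ⟨m, hm, hmem⟩ := hdesc x 0 1 htop
    rw [map_one] at hmem
    exact (h m).2 ((Ideal.eq_top_iff_one _).2 hmem)

end Colimit

theorem IsPerfectClosedCM.exists_isDomain {S : Type*} [CommRing S] [IsLocalRing S]
    [IsNoetherianRing S] {d : ℕ} {x : Fin d → S} (hx : IsSOP S x) {C : Type} [CommRing C] {p : ℕ}
    [Fact p.Prime] (hp : (p : S) = 0) {φ : S →+* C} (h : IsPerfectClosedCM p φ x) :
    ∃ (L : Type) (_ : CommRing L) (g : C →+* L),
      IsDomain L ∧ (Function.Bijective fun c : L => c ^ p) ∧ IsBigCM (g.comp φ) := by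
  let X := {A : Σ R : CommRingCat.{0}, S →+* R // IsPerfectClosedCM p A.2 x}
  have hstep : ∀ A : X, ∃ (A' : X) (g : A.1.1 →+* A'.1.1), g.comp A.1.2 = A'.1.2 ∧
      ∀ a b, a * b = 0 → g a = 0 ∨ g b = 0 := by
    rintro ⟨⟨R, α⟩, hA⟩
    obtain ⟨R', _, g, hg, hgk⟩ := hA.exists_kill_zeroDivisors hp
    exact ⟨⟨⟨CommRingCat.of R', g.comp α⟩, hg⟩, g, rfl, hgk⟩
  choose next t htφ htk using hstep
  let A : ℕ → X := fun n => Nat.rec ⟨⟨CommRingCat.of C, φ⟩, h⟩ (fun _ => next) n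
  let α : ∀ n, S →+* (A n).1.1 := fun n => (A n).1.2
  obtain ⟨L, _, ι, ρ, hρt, hρ1, hρ, hι, hL, h0⟩ :=
    exists_sequential_colimit (C := fun n => (A n).1.1) fun n => t (A n)
  have hρφ : ∀ m n h, (ρ m n h).comp (α m) = α n := by
    intro m n h
    induction n, h using Nat.le_induction with
    | base => rw [hρ1, RingHom.id_comp]
    | succ n hmn ih =>
      rw [← hρ m n (n + 1) hmn n.le_succ, RingHom.comp_assoc, ih, hρt]
      exact htφ (A n)
  have hφ : ∀ n, (ι n).comp (α n) = (ι 0).comp φ := fun n => by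
    rw [← hρφ 0 n n.zero_le, ← RingHom.comp_assoc, hι]
    rfl
  have hιρ : ∀ {m n} (h : m ≤ n) c, ι n (ρ m n h c) = ι m c := fun h c =>
    DFunLike.congr_fun (hι _ _ h) c
  have hcm : IsCMwrt ((ι 0).comp φ) x :=
    isCMwrt_of_colimit hι hρ hL h0 hρφ hφ fun n => (A n).2.isCMwrt
  have hnt := hcm.nontrivial
  have hchar := hcm.charP hp
  have hdom : NoZeroDivisors L := ⟨fun {a b} hab => by
    obtain ⟨m, a, rfl⟩ := hL a
    obtain ⟨n, b, rfl⟩ := hL b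
    rw [← hιρ (le_max_left m n), ← hιρ (le_max_right m n), ← map_mul] at hab
    obtain ⟨k, hk, hzero⟩ := h0 _ _ hab
    rw [map_mul] at hzero
    have := (htk (A k) _ _ hzero).imp (congrArg (ι (k + 1))) (congrArg (ι (k + 1)))
    simpa only [← hρt, hιρ, map_zero] using this⟩
  refine ⟨L, _, ι 0, NoZeroDivisors.to_isDomain L, ⟨frobenius_inj L p, fun z => ?_⟩, ?_⟩
  · obtain ⟨n, c, rfl⟩ := hL z
    obtain ⟨r, hr⟩ := (A n).2.bijective_pow.2 c
    exact ⟨ι n r, by simp only [← map_pow, ← hr]⟩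
  · intro e y hy
    exact isCMwrt_of_colimit hι hρ hL h0 hρφ hφ fun n => (A n).2.isBigCM hx e y hy

end Domain

/-- **Proposition 3.2 (1)** (after Dietz): over a complete noetherian local `k`-algebra `S`
with residue field `k` algebraically closed of characteristic `p`, any
`π^{1/p^∞}`-almost Cohen-Macaulay `S`-algebra `D` maps to a big Cohen-Macaulay `S`-algebra
which is a perfect domain. -/
theorem almost_CM_maps_to_perfect_CM
    (p : ℕ) (hp : p.Prime)
    (k : Type) [Field k] [IsAlgClosed k] [CharP k p]
    (S : Type) [CommRing S] [IsNoetherianRing S] [IsLocalRing S] [Algebra k S]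
    [IsAdicComplete (IsLocalRing.maximalIdeal S) S]
    (hres : Function.Bijective ((IsLocalRing.residue S).comp (algebraMap k S)))
    (d : ℕ) (x : Fin d → S) (hx : IsSOP S x)
    (D : Type) [CommRing D] [Algebra S D]
    (π : ℕ → D) (hπ : ∀ e : ℕ, π (e + 1) ^ p = π e) (hπ0 : π 0 ≠ 0)
    (hACM : IsAlmostCMwrt (algebraMap S D) π x) :
    ∃ (C : Type) (_ : CommRing C) (g : D →+* C),
      IsDomain C ∧
      (Function.Bijective fun c : C => c ^ p) ∧
      IsBigCM (g.comp (algebraMap S D)) := by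
  have : Fact p.Prime := ⟨hp⟩
  have hpS : (p : S) = 0 := by
    rw [← map_natCast (algebraMap k S), CharP.cast_eq_zero, map_zero]
  obtain ⟨C, _, f, hf⟩ := hACM.exists_isPerfectClosedCM hpS hπ
  obtain ⟨L, _, g, hL⟩ := hf.exists_isDomain hx hpS
  exact ⟨L, _, g.comp f, hL⟩
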